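/- In the graph G'' of the TJ-to-TS construction, the k+1 sets V^1 ∪ {f^1}, …, V^k ∪ {f^k} and {z_init, z_fin} are pairwise disjoint cliques whose union is the whole vertex set of G''; consequently, every independent set of G'' of size k+1 contains exactly one vertex from each of these k+1 sets. -/

import Mathlib

/-- `I` is an independent set of the graph `G`. -/
def IsIndepFinset {α : Type*} (G : SimpleGraph α) (I : Finset α) : Prop :=
  ∀ u ∈ I, ∀ v ∈ I, ¬ G.Adj u v

/-- `D` is a dominating set of the graph `G`. -/
def IsDomFinset {α : Type*} (G : SimpleGraph α) (D : Finset α) : Prop :=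
  ∀ x : α, x ∈ D ∨ ∃ y ∈ D, G.Adj x y

/-- A token-jumping step: some token jumps from `u ∈ I` to `w ∉ I`. -/
def TJStep {α : Type*} [DecidableEq α] (I J : Finset α) : Prop :=
  ∃ u ∈ I, ∃ w, w ∉ I ∧ J = insert w (I.erase u)

/-- A token-sliding step: some token slides from `u ∈ I` along an edge to `w ∉ I`. -/
def TSStep {α : Type*} [DecidableEq α] (G : SimpleGraph α) (I J : Finset α) : Prop :=
  ∃ u ∈ I, ∃ w, w ∉ I ∧ G.Adj u w ∧ J = insert w (I.erase u)

/-- A partitioned token-jumping step with respect to token sets `Q`. -/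
def PTJStep {α : Type*} {ι : Type*} [DecidableEq α] (Q : ι → Set α) (I J : Finset α) : Prop :=
  ∃ u ∈ I, ∃ w, w ∉ I ∧ (∃ i, u ∈ Q i ∧ w ∈ Q i) ∧ J = insert w (I.erase u)

/-- A partitioned token-sliding step with respect to token sets `Q`. -/
def PTSStep {α : Type*} {ι : Type*} [DecidableEq α] (G : SimpleGraph α) (Q : ι → Set α)
    (I J : Finset α) : Prop :=
  ∃ u ∈ I, ∃ w, w ∉ I ∧ G.Adj u w ∧ (∃ i, u ∈ Q i ∧ w ∈ Q i) ∧ J = insert w (I.erase u)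

/-- There is a reconfiguration sequence `A = f 0, f 1, …, f ℓ = B` of length `ℓ`, all of whose
members satisfy `Valid`, with consecutive members related by `Step`. -/
def AdmitsSeq {α : Type*} (Valid : Finset α → Prop) (Step : Finset α → Finset α → Prop)
    (A B : Finset α) (ℓ : ℕ) : Prop :=
  ∃ f : ℕ → Finset α, f 0 = A ∧ f ℓ = B ∧ (∀ i, i ≤ ℓ → Valid (f i)) ∧
    ∀ i, i < ℓ → Step (f i) (f (i + 1))

/-- Vertices of the graph `G''` of the TJ-to-TS construction. -/
inductive GVzero (V : Type*) (k : ℕ) : Type _ where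
  | copy : V → Fin k → GVzero V k
  | fv : Fin k → GVzero V k
  | zinit : GVzero V k
  | zfin : GVzero V k
deriving DecidableEq

/-- The edges of `G''`. -/
def relZero {V : Type*} {k : ℕ} (G : SimpleGraph V) (Ifin : Finset V) :
    GVzero V k → GVzero V k → Prop
  | .copy v i, .copy w j => i = j ∨ (i ≠ j ∧ (G.Adj v w ∨ v = w))
  | .fv i, .copy _ j => i = j
  | .fv _, .zinit => True
  | .zinit, .zfin => True
  | .zfin, .copy v _ => v ∉ Ifin
  | _, _ => False

/-- The graph `G''` of the TJ-to-TS construction. -/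
def GppZero {V : Type*} (k : ℕ) (G : SimpleGraph V) (Ifin : Finset V) :
    SimpleGraph (GVzero V k) :=
  SimpleGraph.fromRel (relZero G Ifin)

/-- The `k+1` sets `V^1 ∪ {f^1}, …, V^k ∪ {f^k}` (indexed by `some i`) and `{z_init, z_fin}`
(indexed by `none`). -/
def cliqueSets {V : Type*} {k : ℕ} : Option (Fin k) → Set (GVzero V k)
  | some i => {z | (∃ v, z = GVzero.copy v i) ∨ z = GVzero.fv i}
  | none => {GVzero.zinit, GVzero.zfin}

/-- The index of the member of `cliqueSets` that contains a given vertex. -/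
def cliqueIndex {V : Type*} {k : ℕ} : GVzero V k → Option (Fin k)
  | .copy _ i => some i
  | .fv i => some i
  | .zinit => none
  | .zfin => none

theorem mem_cliqueSets_iff {V : Type*} {k : ℕ} (z : GVzero V k) (o : Option (Fin k)) :
    z ∈ cliqueSets o ↔ cliqueIndex z = o := by
  cases o <;> cases z <;> simp [cliqueSets, cliqueIndex, eq_comm]

theorem GppZero_adj_of_cliqueIndex_eq {V : Type*} {k : ℕ} (G : SimpleGraph V) (Ifin : Finset V)
    {x y : GVzero V k} (hne : x ≠ y) (h : cliqueIndex x = cliqueIndex y) :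
    (GppZero k G Ifin).Adj x y := by
  refine (SimpleGraph.fromRel_adj _ _ _).2 ⟨hne, ?_⟩
  cases x <;> cases y <;> simp_all [relZero, cliqueIndex]

/-- An independent set with as many vertices as there are cliques meets each clique once. -/
theorem existsUnique_cliqueIndex_eq {V : Type*} {k : ℕ} (G : SimpleGraph V) (Ifin : Finset V)
    {I : Finset (GVzero V k)} (hI : IsIndepFinset (GppZero k G Ifin) I) (hcard : I.card = k + 1)
    (o : Option (Fin k)) : ∃! z, z ∈ I ∧ cliqueIndex z = o := by
  have hinj : Set.InjOn cliqueIndex (I : Set (GVzero V k)) := fun x hx y hy hxy => by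
    by_contra hne
    exact hI x hx y hy (GppZero_adj_of_cliqueIndex_eq G Ifin hne hxy)
  have himage : I.image cliqueIndex = Finset.univ := by
    rw [← Finset.card_eq_iff_eq_univ, Finset.card_image_of_injOn hinj, hcard]
    simp
  obtain ⟨z, hz, hzo⟩ := Finset.mem_image.1 (himage ▸ Finset.mem_univ o)
  exact ⟨z, ⟨hz, hzo⟩, fun y hy => hinj hy.1 hz (hy.2.trans hzo.symm)⟩

/-- the `k+1` sets `V^1 ∪ {f^1}, …, V^k ∪ {f^k}` and `{z_init, z_fin}` are
pairwise disjoint cliques of `G''` whose union is the whole vertex set; consequently every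
independent set of `G''` of size `k+1` contains exactly one vertex from each of them. -/
theorem stmt8 {V : Type*} [Fintype V] [DecidableEq V] (G : SimpleGraph V) (k : ℕ)
    (Iinit Ifin : Finset V)
    (hIinit : IsIndepFinset G Iinit) (hIfin : IsIndepFinset G Ifin)
    (hci : Iinit.card = k) (hcf : Ifin.card = k) :
    (∀ o : Option (Fin k), (GppZero k G Ifin).IsClique (cliqueSets o)) ∧
    (∀ o o' : Option (Fin k), o ≠ o' →
      Disjoint (cliqueSets (V := V) o) (cliqueSets o')) ∧
    (⋃ o : Option (Fin k), cliqueSets (V := V) o) = Set.univ ∧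
    (∀ I : Finset (GVzero V k), IsIndepFinset (GppZero k G Ifin) I → I.card = k + 1 →
      ∀ o : Option (Fin k), ∃! z, z ∈ I ∧ z ∈ cliqueSets o) := by
  simp only [mem_cliqueSets_iff]
  refine ⟨fun o x hx y hy hne => ?_, fun o o' hne => ?_, ?_, fun I hI hcard o =>
    existsUnique_cliqueIndex_eq G Ifin hI hcard o⟩
  · rw [mem_cliqueSets_iff] at hx hy
    exact GppZero_adj_of_cliqueIndex_eq G Ifin hne (hx.trans hy.symm)
  · refine Set.disjoint_left.2 fun z hz hz' => hne ?_
    rw [mem_cliqueSets_iff] at hz hz'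
    exact hz.symm.trans hz'
  · exact Set.eq_univ_of_forall fun z => Set.mem_iUnion.2
      ⟨cliqueIndex z, (mem_cliqueSets_iff z _).2 rfl⟩
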